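/- Let d ≥ 3 and Y = ‖x‖² Σ_{k=1}^d x^k ∂_{k+1} (indices mod d). Then the smallest real Lie algebra of vector fields on ℝ^d containing ∂_1 and Y contains all monomial vector fields (x^j)^α ∂_k for all j, k ∈ {1,…,d} and all integers α ≥ 0. -/

import Mathlib

/-- Lie bracket of vector fields on ℝ^m: `[X,Y](x) = DY_x(X(x)) - DX_x(Y(x))`. -/
noncomputable def vfBracket {m : ℕ} (X Y : (Fin m → ℝ) → (Fin m → ℝ)) :
    (Fin m → ℝ) → (Fin m → ℝ) :=
  fun x => fderiv ℝ Y x (X x) - fderiv ℝ X x (Y x)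

/-- The `j`-th standard basis vector of ℝ^m. -/
def stdVec {m : ℕ} (j : Fin m) : Fin m → ℝ :=
  fun k => if k = j then 1 else 0

open MvPolynomial

section PolynomialFields

variable {n : ℕ}

/-- Vector fields on ℝ^n with polynomial coefficients, as derivations. -/
abbrev PolyField (n : ℕ) := Derivation ℝ (MvPolynomial (Fin n) ℝ) (MvPolynomial (Fin n) ℝ)

/-- The evaluation of a polynomial derivation as a vector field. -/
noncomputable def derivationField :
    PolyField n →ₗ[ℝ] ((Fin n → ℝ) → (Fin n → ℝ)) where
  toFun D := fun x k => eval x (D (X k))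
  map_add' D E := by ext x k; simp
  map_smul' c D := by ext x k; simp [smul_eval]

theorem derivationField_apply (D : PolyField n) (x : Fin n → ℝ) (k : Fin n) :
    derivationField D x k = eval x (D (X k)) := rfl

theorem differentiable_eval (p : MvPolynomial (Fin n) ℝ) :
    Differentiable ℝ (fun x : Fin n → ℝ => eval x p) := by
  induction p using MvPolynomial.induction_on with
  | C a => simp
  | add p q hp hq => simpa only [map_add] using hp.fun_add hq
  | mul_X p i hp => simpa only [map_mul, eval_X] using hp.fun_mul (differentiable_apply i)

theorem fderiv_eval_derivationField (D : PolyField n)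
    (p : MvPolynomial (Fin n) ℝ) (x : Fin n → ℝ) :
    fderiv ℝ (fun x : Fin n → ℝ => eval x p) x (derivationField D x) = eval x (D p) := by
  induction p using MvPolynomial.induction_on with
  | C a => simp
  | add p q hp hq =>
    simp only [map_add]
    rw [fderiv_fun_add (differentiable_eval p x) (differentiable_eval q x)]
    simp [hp, hq]
  | mul_X p i hp =>
    simp only [map_mul, eval_X]
    rw [fderiv_fun_mul (differentiable_eval p x) (differentiableAt_apply i x)]
    simp [hp, fderiv_apply, derivationField_apply]

theorem derivationField_lie (D E : PolyField n) :
    derivationField ⁅D, E⁆ = vfBracket (derivationField D) (derivationField E) := by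
  ext x k
  have key (D E : PolyField n) :
      fderiv ℝ (derivationField E) x (derivationField D x) k = eval x (D (E (X k))) := by
    rw [← fderiv_eval_derivationField]
    have h : fderiv ℝ (derivationField E) x = ContinuousLinearMap.pi
        fun i => fderiv ℝ (fun x => eval x (E (X i))) x :=
      fderiv_pi (φ := fun i x => eval x (E (X i))) fun i => differentiable_eval _ x
    rw [h]; rfl
  simp [vfBracket, key, derivationField_apply, Derivation.commutator_apply]

theorem derivation_lie_smul
    (D E : PolyField n)
    (p : MvPolynomial (Fin n) ℝ) : ⁅D, p • E⁆ = D p • E + p • ⁅D, E⁆ := by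
  ext1 k
  simp [Derivation.commutator_apply]
  ring

theorem derivation_smul_lie
    (D E : PolyField n)
    (p : MvPolynomial (Fin n) ℝ) : ⁅p • D, E⁆ = p • ⁅D, E⁆ - E p • D := by
  rw [← lie_skew, derivation_lie_smul, ← lie_skew D E]
  module

theorem derivation_lie_add (D E F : PolyField n) : ⁅D, E + F⁆ = ⁅D, E⁆ + ⁅D, F⁆ :=
  lie_add D E F

theorem derivation_lie_const_smul (D E : PolyField n) (c : ℝ) : ⁅D, c • E⁆ = c • ⁅D, E⁆ :=
  lie_smul c D E

theorem derivation_sum_apply {ι : Type*} (s : Finset ι) (D : ι → PolyField n)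
    (p : MvPolynomial (Fin n) ℝ) : (∑ i ∈ s, D i) p = ∑ i ∈ s, D i p :=
  (congrFun (map_sum Derivation.coeFnAddMonoidHom D s) p).trans (Finset.sum_apply ..)

@[simp] theorem pderiv_two (i : Fin n) : pderiv i (2 : MvPolynomial (Fin n) ℝ) = 0 :=
  (pderiv i).map_natCast 2

theorem lie_pderiv_pderiv (a b : Fin n) :
    ⁅(pderiv a : PolyField n), (pderiv b : PolyField n)⁆ = 0 := by
  ext1 k
  simp [Derivation.commutator_apply, pderiv_X, Pi.single_apply, apply_ite]

theorem lie_smul_pderiv (p q : MvPolynomial (Fin n) ℝ) (a b : Fin n) :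
    ⁅p • (pderiv a : PolyField n), q • pderiv b⁆ =
      (p * pderiv a q) • (pderiv b : PolyField n) - (q * pderiv b p) • pderiv a := by
  rw [derivation_lie_smul, derivation_smul_lie, lie_pderiv_pderiv]
  simp only [smul_zero, zero_sub, Derivation.smul_apply, smul_eq_mul]
  module

/-- The polynomial `‖x‖²`. -/
noncomputable def normSqPoly (n : ℕ) : MvPolynomial (Fin n) ℝ := ∑ l, X l ^ 2

theorem pderiv_normSqPoly (i : Fin n) : pderiv i (normSqPoly n) = 2 * X i := by
  simp [normSqPoly, Derivation.leibniz_pow, pderiv_X, Pi.single_apply, two_mul]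

end PolynomialFields

section CyclicShift

variable {n : ℕ} [NeZero n]

/-- The linear field `Σ_k x^k ∂_{k+1}`. -/
noncomputable def shiftDerivation (n : ℕ) [NeZero n] : PolyField n :=
  mkDerivation ℝ fun k => X (k - 1)

@[simp] theorem shiftDerivation_X (k : Fin n) : shiftDerivation n (X k) = X (k - 1) :=
  mkDerivation_X _ _ _

theorem lie_pderiv_shiftDerivation (i : Fin n) :
    ⁅(pderiv i : PolyField n), shiftDerivation n⁆ = pderiv (i + 1) := by
  ext1 k
  simp [Derivation.commutator_apply, pderiv_X, Pi.single_apply, apply_ite, sub_eq_iff_eq_add]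

theorem sum_smul_pderiv_add_one :
    ∑ i, (X i : MvPolynomial (Fin n) ℝ) • (pderiv (i + 1) : PolyField n) =
      shiftDerivation n := by
  ext1 k
  simp only [derivation_sum_apply, Derivation.smul_apply, pderiv_X,
    Pi.single_apply, smul_eq_mul, mul_ite, mul_one, mul_zero, shiftDerivation_X,
    ← sub_eq_iff_eq_add]
  simp

theorem lie_pderiv_cubic (i : Fin n) :
    ⁅(pderiv i : PolyField n), normSqPoly n • shiftDerivation n⁆ =
      (2 * X i : MvPolynomial (Fin n) ℝ) • shiftDerivation n + normSqPoly n • pderiv (i + 1) := by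
  rw [derivation_lie_smul, pderiv_normSqPoly, lie_pderiv_shiftDerivation]

theorem lie_pderiv_lie_pderiv_cubic_self (i : Fin n) :
    ⁅(pderiv i : PolyField n),
      ⁅(pderiv i : PolyField n), normSqPoly n • shiftDerivation n⁆⁆ =
      (2 : ℝ) • shiftDerivation n +
        (4 : ℝ) • (X i : MvPolynomial (Fin n) ℝ) • pderiv (i + 1) := by
  rw [lie_pderiv_cubic, derivation_lie_add, derivation_lie_smul, derivation_lie_smul,
    pderiv_normSqPoly, lie_pderiv_shiftDerivation, lie_pderiv_pderiv]
  ext1 k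
  simp [MvPolynomial.smul_eq_C_mul, map_ofNat C, pderiv_X]
  ring

theorem lie_pderiv_lie_pderiv_cubic_of_ne {i j : Fin n} (h : i ≠ j) :
    ⁅(pderiv j : PolyField n),
      ⁅(pderiv i : PolyField n), normSqPoly n • shiftDerivation n⁆⁆ =
      (2 : ℝ) • ((X i : MvPolynomial (Fin n) ℝ) • pderiv (j + 1) +
        (X j : MvPolynomial (Fin n) ℝ) • pderiv (i + 1)) := by
  rw [lie_pderiv_cubic, derivation_lie_add, derivation_lie_smul, derivation_lie_smul,
    pderiv_normSqPoly, lie_pderiv_shiftDerivation, lie_pderiv_pderiv]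
  ext1 k
  simp [MvPolynomial.smul_eq_C_mul, map_ofNat C, pderiv_X_of_ne h]
  ring

end CyclicShift

section Generation

variable {d : ℕ}
  {L : LieSubalgebra ℝ (PolyField (d + 3))}

theorem Fin.add_two_ne (a : Fin (d + 3)) : a + 1 + 1 ≠ a := by
  rw [add_assoc, Ne, add_eq_left, Fin.ext_iff]
  simp [Fin.val_add, Nat.mod_eq_of_lt]

theorem pderiv_mem (h₀ : pderiv 0 ∈ L)
    (hY : normSqPoly (d + 3) • shiftDerivation (d + 3) ∈ L) (i : Fin (d + 3)) :
    pderiv i ∈ L := by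
  induction i using Fin.induction with
  | zero => exact h₀
  | succ i hi =>
    rw [← Fin.coeSucc_eq_succ]
    have h := L.lie_mem hi (L.lie_mem hi (L.lie_mem hi hY))
    rw [lie_pderiv_lie_pderiv_cubic_self, derivation_lie_add, derivation_lie_const_smul,
      derivation_lie_const_smul,
      lie_pderiv_shiftDerivation, derivation_lie_smul, lie_pderiv_pderiv, pderiv_X_self,
      smul_zero, add_zero, one_smul, ← add_smul] at h
    exact (L.toSubmodule.smul_mem_iff (by norm_num)).1 h

theorem X_smul_pderiv_mem (h₀ : pderiv 0 ∈ L)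
    (hY : normSqPoly (d + 3) • shiftDerivation (d + 3) ∈ L) (a b : Fin (d + 3)) :
    (X a : MvPolynomial (Fin (d + 3)) ℝ) • pderiv b ∈ L := by
  have hc := pderiv_mem h₀ hY
  have hself (i : Fin (d + 3)) := L.lie_mem (hc i) (L.lie_mem (hc i) hY)
  simp only [lie_pderiv_lie_pderiv_cubic_self] at hself
  have hS : shiftDerivation (d + 3) ∈ L := by
    have h := L.toSubmodule.sum_mem (t := Finset.univ) fun i _ => hself i
    rw [Finset.sum_add_distrib, ← Finset.smul_sum, ← Finset.smul_sum, sum_smul_pderiv_add_one,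
      Finset.sum_const, Finset.card_univ, Fintype.card_fin, ← Nat.cast_smul_eq_nsmul ℝ,
      smul_smul, ← add_smul] at h
    exact (L.toSubmodule.smul_mem_iff (by positivity)).1 h
  have hsucc (i : Fin (d + 3)) :
      (X i : MvPolynomial (Fin (d + 3)) ℝ) • pderiv (i + 1) ∈ L :=
    (L.toSubmodule.smul_mem_iff (s := (4 : ℝ)) (by norm_num)).1 <|
      (L.toSubmodule.add_mem_iff_right (L.smul_mem 2 hS)).1 (hself i)
  have hshift (a c : Fin (d + 3)) :
      c ≠ 0 → (X a : MvPolynomial (Fin (d + 3)) ℝ) • pderiv (a + c) ∈ L := by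
    induction c using Fin.induction with
    | zero => simp
    | succ c ih =>
      intro hne
      rw [← Fin.coeSucc_eq_succ] at hne ⊢
      rw [← add_assoc]
      by_cases h : c.castSucc = 0
      · rw [h, add_zero]; exact hsucc a
      have hne' : a ≠ a + c.castSucc + 1 := by simp [add_assoc]
      have := L.lie_mem (ih h) (hsucc (a + c.castSucc))
      simpa [lie_smul_pderiv, pderiv_X_of_ne hne'] using this
  have hoff {a b : Fin (d + 3)} (h : a ≠ b) :
      (X a : MvPolynomial (Fin (d + 3)) ℝ) • pderiv b ∈ L := by
    simpa only [add_sub_cancel] using hshift a (b - a) (sub_ne_zero.2 h.symm)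
  rcases ne_or_eq a b with h | rfl
  · exact hoff h
  obtain ⟨i, rfl⟩ : ∃ i, a = i + 1 := ⟨a - 1, by simp⟩
  have hne : i + 1 ≠ i := by simp
  have h := L.lie_mem (hc i) (L.lie_mem (hc (i + 1)) hY)
  rw [lie_pderiv_lie_pderiv_cubic_of_ne hne] at h
  exact (L.toSubmodule.add_mem_iff_left (hoff (Fin.add_two_ne i).symm)).1
    ((L.toSubmodule.smul_mem_iff (by norm_num)).1 h)

theorem X_sq_smul_pderiv_self_mem (h₀ : pderiv 0 ∈ L)
    (hY : normSqPoly (d + 3) • shiftDerivation (d + 3) ∈ L) (j : Fin (d + 3)) :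
    (X j ^ 2 : MvPolynomial (Fin (d + 3)) ℝ) • pderiv j ∈ L := by
  have hlin := X_smul_pderiv_mem h₀ hY
  obtain ⟨i, rfl⟩ : ∃ i, j = i + 1 := ⟨j - 1, by simp⟩
  set j := i + 1 with hj
  have hij : i ≠ j := by simp [hj]
  have hj1 : j + 1 ≠ j := by simp
  have hi1 : j + 1 ≠ i := Fin.add_two_ne i
  have hZ := L.lie_mem (pderiv_mem h₀ hY i) hY
  rw [lie_pderiv_cubic, ← hj] at hZ
  have hS : ⁅(X j : MvPolynomial (Fin (d + 3)) ℝ) • (pderiv j : PolyField (d + 3)),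
      shiftDerivation (d + 3)⁆ =
      (X j : MvPolynomial (Fin (d + 3)) ℝ) • pderiv (j + 1) -
        (X i : MvPolynomial (Fin (d + 3)) ℝ) • pderiv j := by
    rw [derivation_smul_lie, lie_pderiv_shiftDerivation, shiftDerivation_X]
    simp [hj]
  have h1 := L.lie_mem (hlin j j) hZ
  have h2 := L.lie_mem (hlin j j) h1
  have e1 : ⁅(X j : MvPolynomial (Fin (d + 3)) ℝ) • (pderiv j : PolyField (d + 3)),
      (2 * X i : MvPolynomial (Fin (d + 3)) ℝ) • shiftDerivation (d + 3) +
        normSqPoly (d + 3) • (pderiv j : PolyField (d + 3))⁆ =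
      (2 * X i * X j : MvPolynomial (Fin (d + 3)) ℝ) • pderiv (j + 1) +
      (2 * X j ^ 2 - 2 * X i ^ 2 - normSqPoly (d + 3)) • (pderiv j : PolyField (d + 3)) := by
    rw [derivation_lie_add, derivation_lie_smul, lie_smul_pderiv, hS]
    ext1 k
    simp [pderiv_X_of_ne hij, pderiv_normSqPoly]
    ring
  have e2 : ⁅(X j : MvPolynomial (Fin (d + 3)) ℝ) • (pderiv j : PolyField (d + 3)),
      (2 * X i * X j : MvPolynomial (Fin (d + 3)) ℝ) • pderiv (j + 1) +
      (2 * X j ^ 2 - 2 * X i ^ 2 - normSqPoly (d + 3)) • (pderiv j : PolyField (d + 3))⁆ =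
      (2 * X i * X j : MvPolynomial (Fin (d + 3)) ℝ) • pderiv (j + 1) +
      (2 * X i ^ 2 + normSqPoly (d + 3)) • (pderiv j : PolyField (d + 3)) := by
    rw [derivation_lie_add, lie_smul_pderiv, lie_smul_pderiv]
    ext1 k
    simp [pderiv_X_of_ne hij, pderiv_X_of_ne hj1.symm, pderiv_normSqPoly,
      Derivation.leibniz_pow]
    ring
  rw [e1] at h1 h2
  rw [e2] at h2
  have h3 := L.add_mem h1 h2
  have e3 : (2 * X i * X j : MvPolynomial (Fin (d + 3)) ℝ) •
        (pderiv (j + 1) : PolyField (d + 3)) +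
      (2 * X j ^ 2 - 2 * X i ^ 2 - normSqPoly (d + 3)) • (pderiv j : PolyField (d + 3)) +
      ((2 * X i * X j : MvPolynomial (Fin (d + 3)) ℝ) • pderiv (j + 1) +
      (2 * X i ^ 2 + normSqPoly (d + 3)) • (pderiv j : PolyField (d + 3))) =
      (4 * X i * X j : MvPolynomial (Fin (d + 3)) ℝ) • pderiv (j + 1) +
      (2 * X j ^ 2 : MvPolynomial (Fin (d + 3)) ℝ) • pderiv j := by
    module
  rw [e3] at h3
  have h4 := L.add_mem h3 (L.lie_mem (hlin (j + 1) (j + 1)) h3)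
  have e4 : (4 * X i * X j : MvPolynomial (Fin (d + 3)) ℝ) •
        (pderiv (j + 1) : PolyField (d + 3)) +
      (2 * X j ^ 2 : MvPolynomial (Fin (d + 3)) ℝ) • pderiv j +
      ⁅(X (j + 1) : MvPolynomial (Fin (d + 3)) ℝ) • (pderiv (j + 1) : PolyField (d + 3)),
        (4 * X i * X j : MvPolynomial (Fin (d + 3)) ℝ) • (pderiv (j + 1) : PolyField (d + 3)) +
        (2 * X j ^ 2 : MvPolynomial (Fin (d + 3)) ℝ) • pderiv j⁆ =
      (2 : ℝ) • (X j ^ 2 : MvPolynomial (Fin (d + 3)) ℝ) • pderiv j := by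
    have h4 : pderiv (j + 1) (4 : MvPolynomial (Fin (d + 3)) ℝ) = 0 :=
      (pderiv (j + 1)).map_natCast 4
    rw [derivation_lie_add, lie_smul_pderiv, lie_smul_pderiv]
    ext1 k
    simp [pderiv_X_of_ne hi1.symm, pderiv_X_of_ne hj1.symm, pderiv_X_of_ne hj1, h4,
      Derivation.leibniz_pow, MvPolynomial.smul_eq_C_mul, map_ofNat C]
    ring
  rw [e4] at h4
  exact (L.toSubmodule.smul_mem_iff (by norm_num)).1 h4

theorem X_pow_smul_pderiv_mem (h₀ : pderiv 0 ∈ L)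
    (hY : normSqPoly (d + 3) • shiftDerivation (d + 3) ∈ L) (j k : Fin (d + 3)) (α : ℕ) :
    (X j ^ α : MvPolynomial (Fin (d + 3)) ℝ) • pderiv k ∈ L := by
  have hlin := X_smul_pderiv_mem h₀ hY
  have hsq := X_sq_smul_pderiv_self_mem h₀ hY
  have hstep {k : Fin (d + 3)} {α : ℕ} (c : ℝ) (hc : c ≠ 0)
      (hcα : ⁅(X j ^ 2 : MvPolynomial (Fin (d + 3)) ℝ) • (pderiv j : PolyField (d + 3)),
        (X j ^ α : MvPolynomial (Fin (d + 3)) ℝ) • pderiv k⁆ =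
        c • (X j ^ (α + 1) : MvPolynomial (Fin (d + 3)) ℝ) • pderiv k)
      (h : (X j ^ α : MvPolynomial (Fin (d + 3)) ℝ) • pderiv k ∈ L) :
      (X j ^ (α + 1) : MvPolynomial (Fin (d + 3)) ℝ) • pderiv k ∈ L :=
    (L.toSubmodule.smul_mem_iff hc).1 (hcα ▸ L.lie_mem (hsq j) h)
  have hoff {k : Fin (d + 3)} (hjk : j ≠ k) (α : ℕ) :
      (X j ^ (α + 1) : MvPolynomial (Fin (d + 3)) ℝ) • pderiv k ∈ L := by
    induction α with
    | zero => simpa using hlin j k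
    | succ α ih =>
      refine hstep (α + 1) (by positivity) ?_ ih
      rw [lie_smul_pderiv]
      ext1 m
      simp [Derivation.leibniz_pow, pderiv_X_of_ne hjk, MvPolynomial.smul_eq_C_mul]
      ring
  have hcube : (X j ^ 3 : MvPolynomial (Fin (d + 3)) ℝ) • pderiv j ∈ L := by
    have hjk : j ≠ j + 1 := by simp
    have hmix {a b : Fin (d + 3)} (hab : a ≠ b) :
        (X a * X b : MvPolynomial (Fin (d + 3)) ℝ) • pderiv a ∈ L := by
      have h := L.lie_mem (hlin b a) (hsq a)
      have e : ⁅(X b : MvPolynomial (Fin (d + 3)) ℝ) • (pderiv a : PolyField (d + 3)),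
          (X a ^ 2 : MvPolynomial (Fin (d + 3)) ℝ) • (pderiv a : PolyField (d + 3))⁆ =
          (2 : ℝ) • (X a * X b : MvPolynomial (Fin (d + 3)) ℝ) • pderiv a := by
        rw [lie_smul_pderiv]
        ext1 m
        simp [Derivation.leibniz_pow, pderiv_X_of_ne hab.symm, MvPolynomial.smul_eq_C_mul,
          map_ofNat C]
        ring
      rw [e] at h
      exact (L.toSubmodule.smul_mem_iff (by norm_num)).1 h
    have h1 := L.lie_mem (hoff hjk 1) (hmix hjk)
    have h2 := L.smul_mem (2 : ℝ) (L.lie_mem (hsq j) (hmix hjk.symm))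
    convert L.add_mem h1 h2 using 1
    simp only [lie_smul_pderiv]
    ext1 m
    simp [Derivation.leibniz_pow, pderiv_X_of_ne hjk, pderiv_X_of_ne hjk.symm,
      MvPolynomial.smul_eq_C_mul, map_ofNat C]
    ring
  have hdiag (α : ℕ) :
      (X j ^ (α + 3) : MvPolynomial (Fin (d + 3)) ℝ) • pderiv j ∈ L := by
    induction α with
    | zero => exact hcube
    | succ α ih =>
      refine hstep (α + 1) (by positivity) ?_ ih
      rw [lie_smul_pderiv]
      ext1 m
      simp [Derivation.leibniz_pow, MvPolynomial.smul_eq_C_mul]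
      ring
  rcases ne_or_eq j k with h | rfl
  · cases α with
    | zero => simpa using pderiv_mem h₀ hY k
    | succ α => exact hoff h α
  · match α with
    | 0 => simpa using pderiv_mem h₀ hY j
    | 1 => simpa using hlin j j
    | 2 => exact hsq j
    | α + 3 => exact hdiag α

end Generation

/-- In dimension `d + 3 ≥ 3`, any real subspace of vector fields on ℝ^(d+3) containing
the constant field `∂_1` and `Y = ‖x‖² Σ_k x^k ∂_{k+1}` (indices mod the dimension) and
closed under the Lie bracket contains every monomial vector field `(x^j)^α ∂_k`;
i.e. the Lie algebra generated by `∂_1` and `Y` contains all of them. -/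
theorem cubic_field_generates_monomials (d : ℕ) :
    ∀ V : Submodule ℝ ((Fin (d + 3) → ℝ) → (Fin (d + 3) → ℝ)),
      (fun _ : Fin (d + 3) → ℝ => stdVec (0 : Fin (d + 3))) ∈ V →
      (fun x : Fin (d + 3) → ℝ => fun k => (∑ l, x l ^ 2) * x (k - 1)) ∈ V →
      (∀ X Y : (Fin (d + 3) → ℝ) → (Fin (d + 3) → ℝ),
        X ∈ V → Y ∈ V → vfBracket X Y ∈ V) →
      ∀ (j k : Fin (d + 3)) (α : ℕ),
        (fun x : Fin (d + 3) → ℝ => x j ^ α • stdVec k) ∈ V := by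
  intro V h₀ hY hV j k α
  let L : LieSubalgebra ℝ (PolyField (d + 3)) :=
    { V.comap derivationField with
      lie_mem' := fun {D E} hD hE => by
        change derivationField ⁅D, E⁆ ∈ V
        rw [derivationField_lie]
        exact hV _ _ hD hE }
  have hfield (p : MvPolynomial (Fin (d + 3)) ℝ) (a : Fin (d + 3)) :
      derivationField (p • pderiv a) = fun x => eval x p • stdVec a := by
    ext x m
    by_cases h : m = a <;> simp [derivationField_apply, stdVec, pderiv_X, h]
  have h₀' : pderiv 0 ∈ L := by
    change derivationField (pderiv 0) ∈ V
    rw [← one_smul (MvPolynomial (Fin (d + 3)) ℝ) (pderiv (0 : Fin (d + 3))), hfield]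
    simpa using h₀
  have hY' : normSqPoly (d + 3) • shiftDerivation (d + 3) ∈ L := by
    change derivationField _ ∈ V
    convert hY using 1
    ext x m
    simp [derivationField_apply, normSqPoly]
  have h : derivationField _ ∈ V := X_pow_smul_pderiv_mem h₀' hY' j k α
  rw [hfield] at h
  simpa using h
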